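/- Let F : ℝ × ℝ → ℝ be a Borel measurable, locally bounded function satisfying both equation (A) and equation (B) with weight ω, and define Ẑ(x,y) := 1 + ∫_y^x ω(z) F(z,y) dz. Then for all x ≥ y one has ∫_y^x Ẑ(x,u) ω(u) W(u−y) du = Ẑ(x,y) − 1. -/

import Mathlib

open MeasureTheory Set

noncomputable section

/-- A real-valued function is locally bounded if it is bounded on every compact set. -/
def LocBdd {α : Type*} [TopologicalSpace α] (f : α → ℝ) : Prop :=
  ∀ K : Set α, IsCompact K → ∃ C : ℝ, ∀ x ∈ K, |f x| ≤ C

theorem integrable_indicator_lt_of_integrableOn_prod {a b : ℝ} {f : ℝ → ℝ → ℝ}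
    (hf : IntegrableOn (Function.uncurry f) (Ioc a b ×ˢ Ioc a b)) :
    Integrable ({p : ℝ × ℝ | p.1 < p.2}.indicator (Function.uncurry f))
      ((volume.restrict (Ioc a b)).prod (volume.restrict (Ioc a b))) := by
  rw [Measure.prod_restrict]
  exact hf.integrable.indicator (measurableSet_lt measurable_fst measurable_snd)

theorem setIntegral_indicator_lt_eq_intervalIntegral {a b u : ℝ} (hu : u ∈ Ioc a b)
    (f : ℝ → ℝ → ℝ) :
    ∫ z in Ioc a b, {p : ℝ × ℝ | p.1 < p.2}.indicator (Function.uncurry f) (u, z)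
      = ∫ z in u..b, f u z := by
  have : ∀ z, {p : ℝ × ℝ | p.1 < p.2}.indicator (Function.uncurry f) (u, z)
      = (Ioi u).indicator (f u) z := fun z => by
    simp [indicator_apply]
  simp only [this]
  rw [intervalIntegral.integral_of_le hu.2, setIntegral_indicator measurableSet_Ioi,
    Ioc_inter_Ioi, sup_eq_right.2 hu.1.le]

/-- Fubini's theorem on the triangle `a < u < z ≤ b`. -/
theorem intervalIntegral_triangle_swap {a b : ℝ} (hab : a ≤ b) {f : ℝ → ℝ → ℝ}
    (hf : IntegrableOn (Function.uncurry f) (Ioc a b ×ˢ Ioc a b)) :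
    ∫ u in a..b, ∫ z in u..b, f u z = ∫ z in a..b, ∫ u in a..z, f u z := by
  have hswap := integral_integral_swap
    (f := fun u z => {p : ℝ × ℝ | p.1 < p.2}.indicator (Function.uncurry f) (u, z))
    (integrable_indicator_lt_of_integrableOn_prod hf)
  rw [intervalIntegral.integral_of_le hab, intervalIntegral.integral_of_le hab]
  convert hswap using 1
  · exact setIntegral_congr_fun measurableSet_Ioc fun u hu =>
      (setIntegral_indicator_lt_eq_intervalIntegral hu f).symm
  · refine setIntegral_congr_fun measurableSet_Ioc fun z hz => ?_
    have : ∀ u, {p : ℝ × ℝ | p.1 < p.2}.indicator (Function.uncurry f) (u, z)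
        = (Iio z).indicator (fun u => f u z) u := fun u => by
      simp [indicator_apply]
    have hset : Ioc a b ∩ Iio z = Ioo a z := by
      ext u
      exact ⟨fun h => ⟨h.1.1, h.2⟩, fun h => ⟨⟨h.1, h.2.le.trans hz.2⟩, h.2⟩⟩
    simp only [this]
    rw [intervalIntegral.integral_of_le hz.1.le, setIntegral_indicator measurableSet_Iio, hset,
      integral_Ioc_eq_integral_Ioo]

theorem intervalIntegrable_intervalIntegral_triangle {a b : ℝ} (hab : a ≤ b) {f : ℝ → ℝ → ℝ}
    (hf : IntegrableOn (Function.uncurry f) (Ioc a b ×ˢ Ioc a b)) :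
    IntervalIntegrable (fun u => ∫ z in u..b, f u z) volume a b := by
  rw [intervalIntegrable_iff_integrableOn_Ioc_of_le hab]
  refine IntegrableOn.congr_fun
    (integrable_indicator_lt_of_integrableOn_prod hf).integral_prod_left (fun u hu => ?_)
    measurableSet_Ioc
  exact setIntegral_indicator_lt_eq_intervalIntegral hu f

theorem LocBdd.mul {α : Type*} [TopologicalSpace α] {f g : α → ℝ} (hf : LocBdd f)
    (hg : LocBdd g) : LocBdd fun x => f x * g x := by
  intro K hK
  obtain ⟨C, hC⟩ := hf K hK
  obtain ⟨D, hD⟩ := hg K hK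
  refine ⟨C * D, fun x hx => ?_⟩
  rw [abs_mul]
  exact mul_le_mul (hC x hx) (hD x hx) (abs_nonneg _) ((abs_nonneg _).trans (hC x hx))

theorem LocBdd.comp_continuous {α β : Type*} [TopologicalSpace α] [TopologicalSpace β]
    {f : β → ℝ} (hf : LocBdd f) {g : α → β} (hg : Continuous g) : LocBdd fun x => f (g x) := by
  intro K hK
  obtain ⟨C, hC⟩ := hf _ (hK.image hg)
  exact ⟨C, fun x hx => hC _ (mem_image_of_mem g hx)⟩

theorem LocBdd.integrableOn_isCompact {α : Type*} [TopologicalSpace α] [T2Space α]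
    [MeasurableSpace α] [BorelSpace α] {μ : Measure α} [IsFiniteMeasureOnCompacts μ] {f : α → ℝ}
    (hf : LocBdd f) (hm : Measurable f) {K : Set α} (hK : IsCompact K) : IntegrableOn f K μ := by
  obtain ⟨C, hC⟩ := hf K hK
  exact IntegrableOn.of_bound hK.measure_lt_top hm.aestronglyMeasurable C
    ((ae_restrict_iff' hK.measurableSet).2 (ae_of_all _ hC))

theorem LocBdd.intervalIntegrable {f : ℝ → ℝ} (hf : LocBdd f) (hm : Measurable f) (a b : ℝ) :
    IntervalIntegrable f volume a b :=
  (hf.integrableOn_isCompact hm isCompact_uIcc).intervalIntegrable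

/-- Identity (3.1) of the paper: `∫_y^x Ẑ(x,u) ω(u) W(u-y) du = Ẑ(x,y) - 1` for `x ≥ y`. -/
theorem statement4
    (W ω : ℝ → ℝ)
    (hWmeas : Measurable W) (hWbdd : LocBdd W) (hWneg : ∀ x : ℝ, x < 0 → W x = 0)
    (hωmeas : Measurable ω) (hωbdd : LocBdd ω) (hωpos : ∀ x : ℝ, 0 ≤ ω x)
    (F : ℝ × ℝ → ℝ) (hFmeas : Measurable F) (hFbdd : LocBdd F)
    (hFA : ∀ x y : ℝ, F (x, y) = W (x - y) + ∫ z in y..x, W (x - z) * ω z * F (z, y))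
    (hFB : ∀ x y : ℝ, F (x, y) = W (x - y) + ∫ z in y..x, F (x, z) * ω z * W (z - y))
    (Zh : ℝ → ℝ → ℝ)
    (hZh : ∀ x y : ℝ, Zh x y = 1 + ∫ z in y..x, ω z * F (z, y)) :
    ∀ x y : ℝ, y ≤ x → ∫ u in y..x, Zh x u * ω u * W (u - y) = Zh x y - 1 := by
  intro x y hxy
  have hWy : LocBdd fun u => W (u - y) := hWbdd.comp_continuous (by fun_prop)
  have hωW : IntervalIntegrable (fun u => ω u * W (u - y)) volume y x :=
    (hωbdd.mul hWy).intervalIntegrable (by fun_prop) y x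
  have hωF : IntervalIntegrable (fun z => ω z * F (z, y)) volume y x :=
    (hωbdd.mul (hFbdd.comp_continuous (g := fun z => (z, y))
      (by fun_prop))).intervalIntegrable (by fun_prop) y x
  have hf : IntegrableOn
      (Function.uncurry fun u z => ω z * F (z, u) * (ω u * W (u - y))) (Ioc y x ×ˢ Ioc y x) := by
    have hbdd : LocBdd fun p : ℝ × ℝ => ω p.2 * F (p.2, p.1) * (ω p.1 * W (p.1 - y)) :=
      ((hωbdd.comp_continuous continuous_snd).mul
        (hFbdd.comp_continuous continuous_swap)).mul
        ((hωbdd.comp_continuous continuous_fst).mul (hWy.comp_continuous continuous_fst))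
    exact (hbdd.integrableOn_isCompact (by fun_prop) (isCompact_Icc.prod isCompact_Icc)).mono_set
      (prod_mono Ioc_subset_Icc_self Ioc_subset_Icc_self)
  have hinner : ∀ z, ∫ u in y..z, ω z * F (z, u) * (ω u * W (u - y))
      = ω z * F (z, y) - ω z * W (z - y) := fun z => by
    rw [hFB z y, mul_add, add_sub_cancel_left, ← intervalIntegral.integral_const_mul]
    exact intervalIntegral.integral_congr fun u _ => by ring
  have hdouble : ∫ u in y..x, (∫ z in u..x, ω z * F (z, u)) * (ω u * W (u - y))
      = (∫ z in y..x, ω z * F (z, y)) - ∫ z in y..x, ω z * W (z - y) := by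
    rw [← intervalIntegral.integral_sub hωF hωW]
    simp_rw [← hinner, ← intervalIntegral.integral_mul_const]
    exact intervalIntegral_triangle_swap hxy hf
  have hdoubleInt : IntervalIntegrable
      (fun u => (∫ z in u..x, ω z * F (z, u)) * (ω u * W (u - y))) volume y x := by
    simp_rw [← intervalIntegral.integral_mul_const]
    exact intervalIntegrable_intervalIntegral_triangle hxy hf
  have hsplit : ∀ u, Zh x u * ω u * W (u - y)
      = ω u * W (u - y) + (∫ z in u..x, ω z * F (z, u)) * (ω u * W (u - y)) := fun u => by
    rw [hZh]; ring
  simp_rw [hsplit]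
  rw [intervalIntegral.integral_add hωW hdoubleInt, hdouble, hZh]
  ring
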